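/- arXiv:2108.00127 — 7 statements merged into one kernel-verified Lean document; each statement's English description precedes it below -/
import Mathlib

section
/- Let n, n1, n2 be real numbers with n1 ≥ 4, n2 ≥ 4, and n ≥ 2·n1·n2, and let p1, p2 ∈ [0.05, 1]. Set s1 = n/n1, s2 = n/n2, r12 = n/(n1·n2), and p_n = ((s2 − 1)/(n − 1))·p2. Then (p1/p2)·(s1 − 1) + (r12 − 1)·(1 − p1) < (1/n2)·((p1/p_n)·(s1 − 1) + (n/n1 − 1)·(1 − p1)). -/
/-- The reduced inequality showing that the modularity of layer 1 is smaller
under structured noise than under equivalent random noise. -/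
theorem stmt_4 (n n1 n2 p1 p2 : ℝ)
    (hn1 : 4 ≤ n1) (hn2 : 4 ≤ n2) (hn : 2 * n1 * n2 ≤ n)
    (hp1 : p1 ∈ Set.Icc (0.05 : ℝ) 1) (hp2 : p2 ∈ Set.Icc (0.05 : ℝ) 1)
    (s1 s2 r12 p_n : ℝ)
    (hs1 : s1 = n / n1) (hs2 : s2 = n / n2) (hr12 : r12 = n / (n1 * n2))
    (hpn : p_n = ((s2 - 1) / (n - 1)) * p2) :
    (p1 / p2) * (s1 - 1) + (r12 - 1) * (1 - p1)
      < (1 / n2) * ((p1 / p_n) * (s1 - 1) + (n / n1 - 1) * (1 - p1)) := by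
  obtain ⟨ha, hb⟩ := hp1
  obtain ⟨hc, hd⟩ := hp2
  have hp1 : 0 < p1 := by norm_num at ha; linarith
  have hp2 : 0 < p2 := by norm_num at hc; linarith
  have h1 : 0 < n1 := by linarith
  have h2 : 0 < n2 := by linarith
  have hA : n1 < n := by nlinarith
  have hB : n2 < n := by nlinarith
  have hs : 0 < s1 - 1 := by
    rw [hs1, sub_pos, lt_div_iff₀ h1]; linarith
  have hn1' : n - 1 ≠ 0 := by linarith
  have hn2' : n - n2 ≠ 0 := by linarith
  have hX : 0 < (p1 / p2) * (s1 - 1) := by positivity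
  have hs2' : s2 - 1 = (n - n2) / n2 := by rw [hs2]; field_simp
  have e1 : (1 / n2) * ((p1 / p_n) * (s1 - 1))
      = (p1 / p2) * (s1 - 1) * ((n - 1) / (n - n2)) := by
    rw [hpn, hs2']; field_simp
  have hr : 1 < (n - 1) / (n - n2) := by
    rw [lt_div_iff₀ (by linarith)]; linarith
  have e2 : (1 / n2) * ((n / n1 - 1) * (1 - p1)) = (r12 - 1 / n2) * (1 - p1) := by
    rw [hr12]; field_simp
  have hi : 1 / n2 ≤ 1 := by rw [div_le_one h2]; linarith
  rw [mul_add, e1, e2]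
  have k1 := mul_lt_mul_of_pos_left hr hX
  have k2 : (r12 - 1) * (1 - p1) ≤ (r12 - 1 / n2) * (1 - p1) :=
    mul_le_mul_of_nonneg_right (by linarith) (by linarith)
  linarith
end

section
/- Let n, n1, n2 be real numbers with n1 ≥ 4, n2 ≥ 4, and n ≥ 2·n1·n2, and let p1, p2 ∈ [0.05, 1]. Set s1 = n/n1, s2 = n/n2, r12 = n/(n1·n2), p12 = p1 + p2 − p1·p2, p_n = ((s2 − 1)/(n − 1))·p2, and p_{1n} = p1 + p_n − p1·p_n. Define the expected edge-set sizes S1 = (1/2)·n·(s1 − r12)·p1, S2 = (1/2)·n·(s2 − r12)·p2, S12 = (1/2)·n·(r12 − 1)·p12, S_{1N} = (1/2)·n·(s1 − 1)·p_{1n}, S_N = (1/2)·n·(n − s1)·p_n. Define e^S_{11} = (1/n1)·(S12 + S1), e^S_{1out} = (2/n1)·S2, e^R_{11} = (1/n1)·S_{1N}, e^R_{1out} = (2/n1)·S_N, and the modularities Q^S = 1 − e^S_{1out}/(e^S_{1out} + 2·e^S_{11}) − 1/n1 and Q^R = 1 − e^R_{1out}/(e^R_{1out} + 2·e^R_{11})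 − 1/n1. Then Q^S < Q^R: the modularity of the ground-truth dominant layer is smaller in the two-layer model (structured noise) than in the one-layer model with equivalent random noise. -/
/-- The modularity of the ground-truth dominant layer is smaller in the two-layer
model (structured noise) than in the one-layer model with equivalent random noise. -/
theorem stmt_5 (n n1 n2 p1 p2 : ℝ)
    (hn1 : 4 ≤ n1) (hn2 : 4 ≤ n2) (hn : 2 * n1 * n2 ≤ n)
    (hp1 : p1 ∈ Set.Icc (0.05 : ℝ) 1) (hp2 : p2 ∈ Set.Icc (0.05 : ℝ) 1)
    (s1 s2 r12 p12 p_n p_1n : ℝ)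
    (hs1 : s1 = n / n1) (hs2 : s2 = n / n2) (hr12 : r12 = n / (n1 * n2))
    (hp12 : p12 = p1 + p2 - p1 * p2)
    (hpn : p_n = ((s2 - 1) / (n - 1)) * p2)
    (hp1n : p_1n = p1 + p_n - p1 * p_n)
    (S1 S2 S12 S_1N S_N : ℝ)
    (hS1 : S1 = (1 / 2) * n * (s1 - r12) * p1)
    (hS2 : S2 = (1 / 2) * n * (s2 - r12) * p2)
    (hS12 : S12 = (1 / 2) * n * (r12 - 1) * p12)
    (hS1N : S_1N = (1 / 2) * n * (s1 - 1) * p_1n)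
    (hSN : S_N = (1 / 2) * n * (n - s1) * p_n)
    (eS11 eS1out eR11 eR1out QS QR : ℝ)
    (heS11 : eS11 = (1 / n1) * (S12 + S1))
    (heS1out : eS1out = (2 / n1) * S2)
    (heR11 : eR11 = (1 / n1) * S_1N)
    (heR1out : eR1out = (2 / n1) * S_N)
    (hQS : QS = 1 - eS1out / (eS1out + 2 * eS11) - 1 / n1)
    (hQR : QR = 1 - eR1out / (eR1out + 2 * eR11) - 1 / n1) :
    QS < QR := by
  obtain ⟨hp1l, hp1u⟩ := hp1
  obtain ⟨hp2l, hp2u⟩ := hp2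
  have hp1pos : 0 < p1 := by norm_num at hp1l; linarith
  have hp2pos : 0 < p2 := by norm_num at hp2l; linarith
  have ha : 0 < n1 := by linarith
  have hb : 0 < n2 := by linarith
  have hab : 16 ≤ n1 * n2 := by nlinarith only [hn1, hn2]
  have hnr : n = r12 * n1 * n2 := by rw [hr12]; field_simp
  have hr : 2 ≤ r12 := by
    rw [hr12, le_div_iff₀ (by positivity)]; linarith
  have hs1' : s1 = r12 * n2 := by rw [hs1, hnr]; field_simp
  have hs2' : s2 = r12 * n1 := by rw [hs2, hnr]; field_simp
  clear hr12 hs1 hs2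
  have hn32 : 32 ≤ n := by linarith
  have hra : 8 ≤ r12 * n1 := by nlinarith only [hn1, hr]
  have hrb : 8 ≤ r12 * n2 := by nlinarith only [hn2, hr]
  obtain ⟨t, ht⟩ : ∃ t, t = (s2 - 1) / (n - 1) := ⟨_, rfl⟩
  have ht0 : 0 < t := by
    rw [ht, hs2']; exact div_pos (by linarith) (by linarith)
  have hbt : n2 * t < 1 := by
    rw [ht, hs2', ← mul_div_assoc, div_lt_one (by linarith), hnr]
    linarith only [hn2, mul_comm n2 (r12 * n1), mul_sub n2 (r12 * n1) 1]
  rw [← ht] at hpn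
  have hpn0 : 0 < p_n := by rw [hpn]; positivity
  have hq : 0 ≤ p2 * (1 - p1) := mul_nonneg hp2pos.le (by linarith)
  have hp1n0 : 0 < p_1n := by 
    have h : 0 ≤ t * (p2 * (1 - p1)) := mul_nonneg ht0.le hq
    rw [hp1n, hpn]; linarith only [h, hp1pos]
  have hp12' : 0 < p12 := by rw [hp12]; linarith only [hq, hp1pos]
  have key : n2 * t * ((r12 * n2 - 1) * p1 + (r12 - 1) * (p2 * (1 - p1)))
      < (r12 * n2 - 1) * (p1 + t * (p2 * (1 - p1))) := by
    have h1 : 0 < (1 - n2 * t) * ((r12 * n2 - 1) * p1) :=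
      mul_pos (by linarith) (mul_pos (by linarith) hp1pos)
    have h2 : 0 ≤ (n2 - 1) * (t * (p2 * (1 - p1))) :=
      mul_nonneg (by linarith) (mul_nonneg ht0.le hq)
    linarith
  have hS2pos : 0 < S2 := by
    rw [hS2, hs2']
    have : 0 < r12 * n1 - r12 := by nlinarith only [hn1, hr]
    have : 0 < n := by linarith
    positivity
  have hSNpos : 0 < S_N := by
    rw [hSN, hs1', hnr]
    have : 0 < r12 * n1 * n2 - r12 * n2 := by nlinarith only [hn1, hrb]
    positivity
  have hS1Npos : 0 < S_1N := by
    rw [hS1N, hs1']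
    have : 0 < r12 * n2 - 1 := by linarith
    have : 0 < n := by linarith
    positivity
  have hSpos : 0 < S12 + S1 := by
    rw [hS12, hS1, hs1']
    have : 0 < r12 * n2 - r12 := by nlinarith only [hn2, hr]
    have : 0 < r12 - 1 := by linarith
    have : 0 < n := by linarith
    positivity
  have main : S_N * (S12 + S1) < S2 * S_1N := by
    have hc : 0 < (n / 2) ^ 2 * (r12 * (n1 - 1) * p2) := by
      have : 0 < n1 - 1 := by linarith
      have : 0 < n := by linarith
      positivity
    have := mul_lt_mul_of_pos_left key hc
    have e1 : S_N * (S12 + S1) = (n / 2) ^ 2 * (r12 * (n1 - 1) * p2) *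
        (n2 * t * ((r12 * n2 - 1) * p1 + (r12 - 1) * (p2 * (1 - p1)))) := by
      have : n - s1 = r12 * n2 * (n1 - 1) := by rw [hs1', hnr]; ring
      rw [hSN, this, hS12, hS1, hs1', hpn, hp12]; ring
    have e2 : S2 * S_1N = (n / 2) ^ 2 * (r12 * (n1 - 1) * p2) *
        ((r12 * n2 - 1) * (p1 + t * (p2 * (1 - p1)))) := by
      rw [hS2, hS1N, hs1', hs2', hp1n, hpn]; ring
    rw [e1, e2]; exact this
  have eS : eS1out / (eS1out + 2 * eS11) = S2 / (S2 + (S12 + S1)) := by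
    rw [heS1out, heS11]; field_simp
  have eR : eR1out / (eR1out + 2 * eR11) = S_N / (S_N + S_1N) := by
    rw [heR1out, heR11]; field_simp
  have : S_N / (S_N + S_1N) < S2 / (S2 + (S12 + S1)) := by
    rw [div_lt_div_iff₀ (by linarith) (by linarith)]
    linarith
  rw [hQS, hQR, eS, eR]
  linarith
end

section
/- In the three-layer stochastic block model, apply ReduceEdge to all communities of layers 1 and 3 with retention probabilities q1, q3 ∈ (0, 3/4]; the expected internal and outgoing edge counts of a community of layer 2 become e'22 = (1/n2)·(S2 + S12·q1 + S23·q3 + S123·q1·q3) and e'2out = (2/n2)·(S1·q1 + S3·q3 + S13·q1·q3). Under the standing assumptions, e'22/e22 > e'2out/e2out, and consequently the modularity of layer 2 strictly increases: 1 − e'2out/(e'2out + 2·e'22) − 1/n2 > 1 − e2out/(e2out + 2·e22) − 1/n2. -/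
theorem union_pos {x y : ℝ} (hx : 0 < x) (hx' : x ≤ 1) (hy : 0 < y) : 0 < x + y - x * y := by
  nlinarith

theorem core_ineq (a c p1 p2 p3 q1 q3 ρ : ℝ) (ha : 3 ≤ a) (hc : 3 ≤ c)
    (h1 : 0 < p1) (h1' : p1 ≤ 1) (h2 : 0 < p2) (h2' : p2 ≤ 1) (h3 : 0 < p3) (h3' : p3 ≤ 1)
    (hq1 : 0 < q1) (hq1' : q1 ≤ 3 / 4) (hq3 : 0 < q3) (hq3' : q3 ≤ 3 / 4)
    (hρ' : ρ ≤ 1) :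
    0 < (a * c * p2 + c * (p1 + p2 - p1 * p2) * q1 + a * (p2 + p3 - p2 * p3) * q3
        + ρ * (1 - (1 - p1) * (1 - p2) * (1 - p3)) * (q1 * q3))
        * (c * p1 + a * p3 + (p1 + p3 - p1 * p3))
      - (c * p1 * q1 + a * p3 * q3 + (p1 + p3 - p1 * p3) * (q1 * q3))
        * (a * c * p2 + c * (p1 + p2 - p1 * p2) + a * (p2 + p3 - p2 * p3)
          + ρ * (1 - (1 - p1) * (1 - p2) * (1 - p3))) := by
  have hC : 0 < p1 + p3 - p1 * p3 := by nlinarith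
  have hP : 0 ≤ 1 - (1 - p1) * (1 - p2) * (1 - p3) := by
    have e1 : (1 - p1) * (1 - p2) ≤ 1 := by nlinarith
    have e0 : 0 ≤ (1 - p1) * (1 - p2) := mul_nonneg (by linarith) (by linarith)
    nlinarith
  have hqq : 0 < 1 - q1 * q3 := by nlinarith
  have t0 : 0 < (p1 + p3 - p1 * p3) * (1 - q1 * q3) := mul_pos hC hqq
  have hA : 3 / 4 * p1 ≤ c * p1 * (1 - q1) := by
    have : 3 / 4 ≤ c * (1 - q1) := by nlinarith
    nlinarith
  have hB : 3 / 4 * p3 ≤ a * p3 * (1 - q3) := by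
    have : 3 / 4 ≤ a * (1 - q3) := by nlinarith
    nlinarith
  have hD : 0 ≤ 3 / 4 * p1 + 3 / 4 * p3 + (q1 - q3) * (p3 - p1) := by
    have u1 : 0 ≤ p1 * (3 / 4 - q1 + q3) := mul_nonneg h1.le (by linarith)
    have u2 : 0 ≤ p3 * (3 / 4 + q1 - q3) := mul_nonneg h3.le (by linarith)
    linarith
  have T1 : 0 < a * c * p2 * (c * p1 * (1 - q1) + a * p3 * (1 - q3)
      + (p1 + p3 - p1 * p3) * (1 - q1 * q3) + (q1 - q3) * (p3 - p1)) := by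
    apply mul_pos
    · have : 0 < a := by linarith
      have : 0 < c := by linarith
      positivity
    · linarith
  have T2 : 0 ≤ c * q1 * (1 - q3) * ((1 - p1) * p2 * p3
      + (1 - ρ) * (p1 * (1 - (1 - p1) * (1 - p2) * (1 - p3)))) := by
    apply mul_nonneg
    · exact mul_nonneg (mul_nonneg (by linarith) hq1.le) (by linarith)
    · exact add_nonneg (mul_nonneg (mul_nonneg (by linarith) h2.le) h3.le)
        (mul_nonneg (by linarith) (mul_nonneg h1.le hP))
  have T3 : 0 ≤ a * q3 * (1 - q1) * ((1 - p3) * p2 * p1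
      + (1 - ρ) * (p3 * (1 - (1 - p1) * (1 - p2) * (1 - p3)))) := by
    apply mul_nonneg
    · exact mul_nonneg (mul_nonneg (by linarith) hq3.le) (by linarith)
    · exact add_nonneg (mul_nonneg (mul_nonneg (by linarith) h2.le) h1.le)
        (mul_nonneg (by linarith) (mul_nonneg h3.le hP))
  linear_combination T1 + T2 + T3

/-- Applying ReduceEdge with retention probabilities `q1, q3 ∈ (0, 3/4]` to layers
1 and 3 of a three-layer stochastic block model strictly increases the modularity
of layer 2. -/
theorem stmt_10 (n n1 n2 n3 p1 p2 p3 q1 q3 : ℝ)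
    (hn1 : 4 ≤ n1) (hn2 : 4 ≤ n2) (hn3 : 4 ≤ n3) (hn : 2 * n1 * n2 * n3 ≤ n)
    (hp1 : p1 ∈ Set.Icc (0.05 : ℝ) 1) (hp2 : p2 ∈ Set.Icc (0.05 : ℝ) 1)
    (hp3 : p3 ∈ Set.Icc (0.05 : ℝ) 1)
    (hq1 : q1 ∈ Set.Ioc (0 : ℝ) (3 / 4)) (hq3 : q3 ∈ Set.Ioc (0 : ℝ) (3 / 4))
    (r123 p12 p13 p23 p123 : ℝ)
    (hr123 : r123 = n / (n1 * n2 * n3))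
    (hp12 : p12 = p1 + p2 - p1 * p2) (hp13 : p13 = p1 + p3 - p1 * p3)
    (hp23 : p23 = p2 + p3 - p2 * p3)
    (hp123 : p123 = 1 - (1 - p1) * (1 - p2) * (1 - p3))
    (S1 S2 S3 S12 S13 S23 S123 : ℝ)
    (hS1 : S1 = (1 / 2) * n * (n2 - 1) * (n3 - 1) * r123 * p1)
    (hS2 : S2 = (1 / 2) * n * (n1 - 1) * (n3 - 1) * r123 * p2)
    (hS3 : S3 = (1 / 2) * n * (n1 - 1) * (n2 - 1) * r123 * p3)
    (hS12 : S12 = (1 / 2) * n * (n3 - 1) * r123 * p12)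
    (hS13 : S13 = (1 / 2) * n * (n2 - 1) * r123 * p13)
    (hS23 : S23 = (1 / 2) * n * (n1 - 1) * r123 * p23)
    (hS123 : S123 = (1 / 2) * n * (r123 - 1) * p123)
    (e22 e2out e'22 e'2out : ℝ)
    (he22 : e22 = (1 / n2) * (S2 + S12 + S23 + S123))
    (he2out : e2out = (2 / n2) * (S1 + S3 + S13))
    (he'22 : e'22 = (1 / n2) * (S2 + S12 * q1 + S23 * q3 + S123 * (q1 * q3)))
    (he'2out : e'2out = (2 / n2) * (S1 * q1 + S3 * q3 + S13 * (q1 * q3))) :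
    e'22 / e22 > e'2out / e2out
    ∧ 1 - e'2out / (e'2out + 2 * e'22) - 1 / n2
        > 1 - e2out / (e2out + 2 * e22) - 1 / n2 := by
  obtain ⟨h1, h1'⟩ := hp1
  obtain ⟨h2, h2'⟩ := hp2
  obtain ⟨h3, h3'⟩ := hp3
  obtain ⟨hq1, hq1'⟩ := hq1
  obtain ⟨hq3, hq3'⟩ := hq3
  have h1 : 0 < p1 := lt_of_lt_of_le (by norm_num) h1
  have h2 : 0 < p2 := lt_of_lt_of_le (by norm_num) h2
  have h3 : 0 < p3 := lt_of_lt_of_le (by norm_num) h3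
  have m1 : 0 < n1 := by linarith
  have m2 : 0 < n2 := by linarith
  have m3 : 0 < n3 := by linarith
  have hm : 0 < n1 * n2 * n3 := by positivity
  have hn0 : 0 < n := by linarith
  have hr : 2 ≤ r123 := by
    rw [hr123, le_div_iff₀ hm]; linarith
  have hr0 : 0 < r123 := by linarith
  have c12 : 0 < p12 := by rw [hp12]; exact union_pos h1 h1' h2
  have c13 : 0 < p13 := by rw [hp13]; exact union_pos h1 h1' h3
  have c23 : 0 < p23 := by rw [hp23]; exact union_pos h2 h2' h3
  have c123 : 0 < p123 := by
    have : p123 = p12 + (1 - p1) * (1 - p2) * p3 := by rw [hp123, hp12]; ring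
    have : 0 ≤ (1 - p1) * (1 - p2) * p3 :=
      mul_nonneg (mul_nonneg (by linarith) (by linarith)) h3.le
    linarith
  have d1 : 0 < n1 - 1 := by linarith
  have d2 : 0 < n2 - 1 := by linarith
  have d3 : 0 < n3 - 1 := by linarith
  have dr : 0 < r123 - 1 := by linarith
  have s1 : 0 < S1 := by rw [hS1]; positivity
  have s2 : 0 < S2 := by rw [hS2]; positivity
  have s3 : 0 < S3 := by rw [hS3]; positivity
  have s12 : 0 < S12 := by rw [hS12]; positivity
  have s13 : 0 < S13 := by rw [hS13]; positivity
  have s23 : 0 < S23 := by rw [hS23]; positivity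
  have s123 : 0 < S123 := by rw [hS123]; positivity
  have x : 0 < e22 := by rw [he22]; positivity
  have y : 0 < e2out := by rw [he2out]; positivity
  have x' : 0 < e'22 := by rw [he'22]; positivity
  have y' : 0 < e'2out := by rw [he'2out]; positivity
  have key : e'2out * e22 < e'22 * e2out := by
    have hc := core_ineq (n1 - 1) (n3 - 1) p1 p2 p3 q1 q3 ((r123 - 1) / r123)
      (by linarith) (by linarith) h1 h1' h2 h2' h3 h3' hq1 hq1' hq3 hq3'
      (by rw [div_le_one hr0]; linarith)
    rw [← hp12, ← hp13, ← hp23, ← hp123] at hc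
    have hK : 0 < 2 / n2 ^ 2 * ((1 / 2) * n * r123) ^ 2 * (n2 - 1) := by positivity
    have hf := mul_pos hK hc
    have hS : S123 = (1 / 2) * n * r123 * ((r123 - 1) / r123) * p123 := by
      rw [hS123]; field_simp
    generalize (r123 - 1) / r123 = ρ at hf hS
    generalize n1 - 1 = a at *
    generalize n2 - 1 = b at *
    generalize n3 - 1 = c at *
    rw [← sub_pos]
    refine lt_of_lt_of_eq hf ?_
    rw [he22, he2out, he'22, he'2out, hS, hS1, hS2, hS3, hS12, hS13, hS23]
    ring
  constructor
  · rw [gt_iff_lt, div_lt_div_iff₀ y x]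
    exact key
  · have : e'2out / (e'2out + 2 * e'22) < e2out / (e2out + 2 * e22) := by
      rw [div_lt_div_iff₀ (by positivity) (by positivity)]
      linarith
    linarith
end

section
/- Let n1, n3 be reals with n1 ≥ 4 and n3 ≥ 4, let p1, p2, p3 ∈ [0.05, 1], and let q1, q3 ∈ (0, 3/4]. With p_ij = p_i + p_j − p_i·p_j and p123 = 1 − (1−p1)(1−p2)(1−p3), the following inequality holds: (1 − q1)·((n3 − 1)·p1·p2 + p1·p23 − p3·p12 + (p23·p13 − p3·p123)·q3) + (1 − q3)·((n1 − 1)·p2·p3 + p3·p12 − p1·p23 + (p12·p13 − p1·p123)·q1) + (1 − q1·q3)·p2·p13 > 0. -/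
/-- The algebraic core of the proof that ReduceEdge applied to layers 1 and 3 of a
three-layer stochastic block model increases the modularity of layer 2. -/
theorem stmt_11 (n1 n3 p1 p2 p3 q1 q3 : ℝ)
    (hn1 : 4 ≤ n1) (hn3 : 4 ≤ n3)
    (hp1 : p1 ∈ Set.Icc (0.05 : ℝ) 1) (hp2 : p2 ∈ Set.Icc (0.05 : ℝ) 1)
    (hp3 : p3 ∈ Set.Icc (0.05 : ℝ) 1)
    (hq1 : q1 ∈ Set.Ioc (0 : ℝ) (3 / 4)) (hq3 : q3 ∈ Set.Ioc (0 : ℝ) (3 / 4))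
    (p12 p13 p23 p123 : ℝ)
    (hp12 : p12 = p1 + p2 - p1 * p2) (hp13 : p13 = p1 + p3 - p1 * p3)
    (hp23 : p23 = p2 + p3 - p2 * p3)
    (hp123 : p123 = 1 - (1 - p1) * (1 - p2) * (1 - p3)) :
    (1 - q1) * ((n3 - 1) * p1 * p2 + p1 * p23 - p3 * p12
        + (p23 * p13 - p3 * p123) * q3)
    + (1 - q3) * ((n1 - 1) * p2 * p3 + p3 * p12 - p1 * p23
        + (p12 * p13 - p1 * p123) * q1)
    + (1 - q1 * q3) * p2 * p13 > 0 := by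
  obtain ⟨a0, a1⟩ := hp1
  obtain ⟨b0, b1⟩ := hp2
  obtain ⟨c0, c1⟩ := hp3
  obtain ⟨q0, q1'⟩ := hq1
  obtain ⟨r0, r1⟩ := hq3
  have ha : 0 < p1 := by norm_num at a0; linarith
  have hb : 0 < p2 := by norm_num at b0; linarith
  have hc : 0 < p3 := by norm_num at c0; linarith
  subst hp12 hp13 hp23 hp123
  have t1 : 0 ≤ p1 * (4 * (1 - q1) - (1 - q3)) := mul_nonneg ha.le (by linarith)
  have t2 : 0 ≤ p3 * (4 * (1 - q3) - (1 - q1)) := mul_nonneg hc.le (by linarith)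
  have t3 : 0 ≤ (1 - q1) * p1 * (n3 - 4) :=
    mul_nonneg (mul_nonneg (by linarith) ha.le) (by linarith)
  have t4 : 0 ≤ (1 - q3) * p3 * (n1 - 4) :=
    mul_nonneg (mul_nonneg (by linarith) hc.le) (by linarith)
  have t5 : 0 ≤ (1 - q1) * q3 * (p1 * (1 - p3)) :=
    mul_nonneg (mul_nonneg (by linarith) r0.le) (mul_nonneg ha.le (by linarith))
  have t6 : 0 ≤ (1 - q3) * q1 * (p3 * (1 - p1)) :=
    mul_nonneg (mul_nonneg (by linarith) q0.le) (mul_nonneg hc.le (by linarith))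
  have t7 : 0 < (1 - q1 * q3) * (p1 + p3 * (1 - p1)) :=
    mul_pos (by nlinarith) (add_pos_of_pos_of_nonneg ha (mul_nonneg hc.le (by linarith)))
  have key := mul_pos hb (add_pos_of_nonneg_of_pos
    (add_nonneg (add_nonneg (add_nonneg t1 t2) (add_nonneg t3 t4)) (add_nonneg t5 t6)) t7)
  refine lt_of_lt_of_eq key ?_
  ring
end

section
/- Let ι be a nonempty finite index set and let F, P, K : ι → ℝ be functions such that F(i) > 0 for all i, such that for all i, j, if P(i) ≤ P(j) then K(j) ≤ K(i) (K is antitone with respect to P), and such that there exist i, j with P(i) < P(j) and K(j) < K(i). Then (∑_i F(i)·P(i))·(∑_i F(i)·K(i)) > (∑_i F(i)·P(i)·K(i))·(∑_i F(i)). -/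
open Finset

/-- Strict Chebyshev-type rearrangement inequality: the core of the proof that any
suitable reducing method increases the modularity of the target layer. -/
theorem stmt_12 {ι : Type*} [Fintype ι] [Nonempty ι] (F P K : ι → ℝ)
    (hF : ∀ i, 0 < F i)
    (hAnti : ∀ i j, P i ≤ P j → K j ≤ K i)
    (hStrict : ∃ i j, P i < P j ∧ K j < K i) :
    (∑ i, F i * P i) * (∑ i, F i * K i)
      > (∑ i, F i * P i * K i) * (∑ i, F i) := by
  have key : ∑ i, ∑ j, F i * F j * ((P i - P j) * (K j - K i))
      = 2 * ((∑ i, F i * P i) * (∑ i, F i * K i) - (∑ i, F i * P i * K i) * (∑ i, F i)) := by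
    have e1 : ∀ i j, F i * F j * ((P i - P j) * (K j - K i))
        = (F i * P i) * (F j * K j) + (F i * K i) * (F j * P j)
          - (F i * P i * K i) * F j - F i * (F j * P j * K j) := by
      intro i j; ring
    simp only [e1, Finset.sum_sub_distrib, Finset.sum_add_distrib, ← Finset.sum_mul_sum]
    ring
  have hnn : ∀ i j, 0 ≤ F i * F j * ((P i - P j) * (K j - K i)) := by
    intro i j
    refine mul_nonneg (mul_pos (hF i) (hF j)).le ?_
    rcases le_total (P i) (P j) with h | h
    · exact mul_nonneg_of_nonpos_of_nonpos (sub_nonpos.2 h) (sub_nonpos.2 (hAnti i j h))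
    · exact mul_nonneg (sub_nonneg.2 h) (sub_nonneg.2 (hAnti j i h))
  obtain ⟨a, b, hP, hK⟩ := hStrict
  have hpos : 0 < ∑ i, ∑ j, F i * F j * ((P i - P j) * (K j - K i)) := by
    refine Finset.sum_pos' (fun i _ => Finset.sum_nonneg fun j _ => hnn i j)
      ⟨a, Finset.mem_univ a, Finset.sum_pos' (fun j _ => hnn a j) ⟨b, Finset.mem_univ b, ?_⟩⟩
    exact mul_pos (mul_pos (hF a) (hF b)) (mul_pos_of_neg_of_neg (sub_neg.2 hP) (sub_neg.2 hK))
  linarith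
end

section
/- Let ι be a nonempty finite index set, let F, P, K : ι → ℝ satisfy: F(i) > 0, 0 ≤ P(i) ≤ 1, and 0 ≤ K(i) ≤ 1 for all i; for all i, j, if P(i) ≤ P(j) then K(j) ≤ K(i); and there exist i, j with P(i) < P(j) and K(j) < K(i). Let p* ∈ (0, 1]. Then (∑_i F(i)·P(i)·K(i)) / (∑_i F(i)·P(i)) < (∑_i F(i)·(p* + (1 − p*)·P(i))·K(i)) / (∑_i F(i)·(p* + (1 − p*)·P(i))). That is, a suitable reducing method keeps a strictly larger fraction of the target layer's internal edges than of its outgoing edges. -/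
open Finset

/-- A suitable reducing method keeps a strictly larger fraction of the target
layer's internal edges than of its outgoing edges. -/
theorem stmt_13 {ι : Type*} [Fintype ι] [Nonempty ι] (F P K : ι → ℝ) (pstar : ℝ)
    (hF : ∀ i, 0 < F i)
    (hP : ∀ i, P i ∈ Set.Icc (0 : ℝ) 1)
    (hK : ∀ i, K i ∈ Set.Icc (0 : ℝ) 1)
    (hAnti : ∀ i j, P i ≤ P j → K j ≤ K i)
    (hStrict : ∃ i j, P i < P j ∧ K j < K i)
    (hpstar : pstar ∈ Set.Ioc (0 : ℝ) 1) :
    (∑ i, F i * P i * K i) / (∑ i, F i * P i)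
      < (∑ i, F i * (pstar + (1 - pstar) * P i) * K i)
          / (∑ i, F i * (pstar + (1 - pstar) * P i)) := by
  obtain ⟨hp0, hp1⟩ := hpstar
  obtain ⟨a, b, hab, hkab⟩ := hStrict
  have hA : 0 < ∑ i, F i * P i := by
    refine Finset.sum_pos' (fun i _ => mul_nonneg (hF i).le (hP i).1) ⟨b, mem_univ _, ?_⟩
    exact mul_pos (hF b) (lt_of_le_of_lt (hP a).1 hab)
  have hS : 0 < ∑ i, F i := Finset.sum_pos (fun i _ => hF i) univ_nonempty
  have hterm : ∀ i j, 0 ≤ F i * F j * ((P i - P j) * (K j - K i)) := by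
    intro i j
    refine mul_nonneg (mul_pos (hF i) (hF j)).le ?_
    rcases le_total (P i) (P j) with h | h
    · have := hAnti i j h
      exact mul_nonneg_of_nonpos_of_nonpos (by linarith) (by linarith)
    · have := hAnti j i h
      exact mul_nonneg (by linarith) (by linarith)
  have hpos : 0 < ∑ i, ∑ j, F i * F j * ((P i - P j) * (K j - K i)) := by
    refine Finset.sum_pos' (fun i _ => Finset.sum_nonneg fun j _ => hterm i j)
      ⟨a, mem_univ _, Finset.sum_pos' (fun j _ => hterm a j) ⟨b, mem_univ _, ?_⟩⟩
    exact mul_pos (mul_pos (hF a) (hF b))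
      (mul_pos_of_neg_of_neg (by linarith) (by linarith))
  have hexp : ∑ i, ∑ j, F i * F j * ((P i - P j) * (K j - K i))
      = (∑ i, F i * P i) * (∑ j, F j * K j) - (∑ i, F i * P i * K i) * (∑ j, F j)
        - (∑ i, F i) * (∑ j, F j * P j * K j) + (∑ i, F i * K i) * (∑ j, F j * P j) := by
    simp only [Finset.sum_mul_sum, ← Finset.sum_sub_distrib, ← Finset.sum_add_distrib]
    refine Finset.sum_congr rfl fun i _ => Finset.sum_congr rfl fun j _ => ?_
    ring
  have hD : ∑ i, F i * (pstar + (1 - pstar) * P i)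
      = pstar * (∑ i, F i) + (1 - pstar) * ∑ i, F i * P i := by
    simp only [Finset.mul_sum, ← Finset.sum_add_distrib]
    exact Finset.sum_congr rfl fun i _ => by ring
  have hN : ∑ i, F i * (pstar + (1 - pstar) * P i) * K i
      = pstar * (∑ i, F i * K i) + (1 - pstar) * ∑ i, F i * P i * K i := by
    simp only [Finset.mul_sum, ← Finset.sum_add_distrib]
    exact Finset.sum_congr rfl fun i _ => by ring
  rw [hexp] at hpos
  rw [hD, hN]
  generalize (∑ i, F i * P i * K i) = B at *
  generalize (∑ i, F i * K i) = C at *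
  generalize (∑ i, F i * P i) = A at *
  generalize (∑ i, F i) = S at *
  have hden : 0 < pstar * S + (1 - pstar) * A :=
    add_pos_of_pos_of_nonneg (mul_pos hp0 hS) (mul_nonneg (by linarith) hA.le)
  rw [div_lt_div_iff₀ hA hden]
  have h : 0 < A * C - B * S := by linarith
  nlinarith [mul_pos hp0 h]
end

section
/- Let ι be a nonempty finite index set, let F, P, K : ι → ℝ satisfy: F(i) > 0, 0 ≤ P(i) ≤ 1, and 0 ≤ K(i) ≤ 1 for all i; for all i, j, if P(i) ≤ P(j) then K(j) ≤ K(i); and there exist i, j with P(i) < P(j) and K(j) < K(i). Let p* ∈ (0, 1], let c_in, c_out > 0, and let n_l > 0. Define e_ll = c_in·∑_i F(i)·(p* + (1 − p*)·P(i)), e_out = c_out·∑_i F(i)·P(i), e'_ll = c_in·∑_i F(i)·(p* + (1 − p*)·P(i))·K(i), and e'_out = c_out·∑_i F(i)·P(i)·K(i). Then 1 − e'_out/(e'_out + 2·e'_ll) − 1/n_l > 1 − e_out/(e_out + 2·e_ll) − 1/n_l: applying any suitable reducing method to all communities of the non-target layers of a multi-layer stochastic block model strictly increases the modularity of the target layer.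 -/
open Finset

/-- Applying any suitable reducing method to all communities of the non-target
layers of a multi-layer stochastic block model strictly increases the modularity
of the target layer. -/
theorem stmt_14 {ι : Type*} [Fintype ι] [Nonempty ι] (F P K : ι → ℝ)
    (pstar c_in c_out n_l : ℝ)
    (hF : ∀ i, 0 < F i)
    (hP : ∀ i, P i ∈ Set.Icc (0 : ℝ) 1)
    (hK : ∀ i, K i ∈ Set.Icc (0 : ℝ) 1)
    (hAnti : ∀ i j, P i ≤ P j → K j ≤ K i)
    (hStrict : ∃ i j, P i < P j ∧ K j < K i)
    (hpstar : pstar ∈ Set.Ioc (0 : ℝ) 1)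
    (hcin : 0 < c_in) (hcout : 0 < c_out) (hnl : 0 < n_l)
    (e_ll e_out e'_ll e'_out : ℝ)
    (h_ll : e_ll = c_in * ∑ i, F i * (pstar + (1 - pstar) * P i))
    (h_out : e_out = c_out * ∑ i, F i * P i)
    (h'_ll : e'_ll = c_in * ∑ i, F i * (pstar + (1 - pstar) * P i) * K i)
    (h'_out : e'_out = c_out * ∑ i, F i * P i * K i) :
    1 - e'_out / (e'_out + 2 * e'_ll) - 1 / n_l
      > 1 - e_out / (e_out + 2 * e_ll) - 1 / n_l := by
  obtain ⟨hp0, hp1⟩ := hpstar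
  obtain ⟨a, b, hab, hKab⟩ := hStrict
  have hnn : ∀ i j, 0 ≤ F i * F j * ((P j - P i) * (K i - K j)) := by
    intro i j
    refine mul_nonneg (mul_pos (hF i) (hF j)).le ?_
    rcases le_total (P i) (P j) with h | h
    · exact mul_nonneg (sub_nonneg.2 h) (sub_nonneg.2 (hAnti _ _ h))
    · exact mul_nonneg_of_nonpos_of_nonpos (sub_nonpos.2 h) (sub_nonpos.2 (hAnti _ _ h))
  have hpos : 0 < ∑ i, ∑ j, F i * F j * ((P j - P i) * (K i - K j)) := by
    refine Finset.sum_pos' (fun i _ => Finset.sum_nonneg fun j _ => hnn i j)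
      ⟨a, Finset.mem_univ _, Finset.sum_pos' (fun j _ => hnn a j) ⟨b, Finset.mem_univ _, ?_⟩⟩
    exact mul_pos (mul_pos (hF a) (hF b)) (mul_pos (sub_pos.2 hab) (sub_pos.2 hKab))
  have hexp : ∑ i, ∑ j, F i * F j * ((P j - P i) * (K i - K j))
      = 2 * ((∑ i, F i * P i) * (∑ i, F i * K i) - (∑ i, F i) * ∑ i, F i * P i * K i) := by
    have h1 : ∀ i j, F i * F j * ((P j - P i) * (K i - K j))
        = (F i * K i) * (F j * P j) - F i * (F j * P j * K j)
          - (F i * P i * K i) * F j + (F i * P i) * (F j * K j) := by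
      intro i j; ring
    simp only [h1, Finset.sum_add_distrib, Finset.sum_sub_distrib, ← Finset.mul_sum,
      ← Finset.sum_mul]
    ring
  rw [hexp] at hpos
  have e1 : ∑ i, F i * (pstar + (1 - pstar) * P i)
      = pstar * (∑ i, F i) + (1 - pstar) * ∑ i, F i * P i := by
    simp only [Finset.mul_sum, ← Finset.sum_add_distrib]
    exact Finset.sum_congr rfl fun i _ => by ring
  have e2 : ∑ i, F i * (pstar + (1 - pstar) * P i) * K i
      = pstar * (∑ i, F i * K i) + (1 - pstar) * ∑ i, F i * P i * K i := by
    simp only [Finset.mul_sum, ← Finset.sum_add_distrib]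
    exact Finset.sum_congr rfl fun i _ => by ring
  have hA : 0 < ∑ i, F i := Finset.sum_pos (fun i _ => hF i) Finset.univ_nonempty
  have hB : 0 ≤ ∑ i, F i * P i := Finset.sum_nonneg fun i _ => mul_nonneg (hF i).le (hP i).1
  have hC : 0 < ∑ i, F i * K i :=
    Finset.sum_pos' (fun i _ => mul_nonneg (hF i).le (hK i).1)
      ⟨a, Finset.mem_univ _, mul_pos (hF a) ((hK b).1.trans_lt hKab)⟩
  have hD : 0 ≤ ∑ i, F i * P i * K i :=
    Finset.sum_nonneg fun i _ => mul_nonneg (mul_nonneg (hF i).le (hP i).1) (hK i).1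
  rw [e1] at h_ll
  rw [e2] at h'_ll
  generalize (∑ i, F i) = A at *
  generalize (∑ i, F i * P i) = B at *
  generalize (∑ i, F i * K i) = C at *
  generalize (∑ i, F i * P i * K i) = D at *
  have hq : 0 ≤ 1 - pstar := by linarith
  have l1 : 0 < e_ll := by rw [h_ll]; positivity
  have l2 : 0 < e'_ll := by rw [h'_ll]; positivity
  have o1 : 0 ≤ e_out := by rw [h_out]; positivity
  have o2 : 0 ≤ e'_out := by rw [h'_out]; positivity
  have key : 0 < e_out * e'_ll - e'_out * e_ll := by
    have : e_out * e'_ll - e'_out * e_ll = c_out * c_in * pstar * (B * C - A * D) := by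
      rw [h_ll, h'_ll, h_out, h'_out]; ring
    rw [this]
    exact mul_pos (by positivity) (by linarith)
  have : e'_out / (e'_out + 2 * e'_ll) < e_out / (e_out + 2 * e_ll) := by
    rw [div_lt_div_iff₀ (by positivity) (by positivity)]
    linarith
  linarith
end
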